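/- arXiv:1511.06478 — 4 statements merged into one kernel-verified Lean document; each statement's English description precedes it below -/
import Mathlib

section
/- For every integer r ≥ 2, every nonempty finite set A of integers is an asymptotic (r, r+1)-approximate group; that is, there exists a positive integer h₁ such that for every integer h ≥ h₁ there is a set X of integers with |X| ≤ r+1 and r(hA) ⊆ X + hA, where hA denotes the h-fold sumset of A. -/
open Pointwise

/-- The `h`-fold sumset `A + A + ⋯ + A` of a finite set of integers. -/
def hsum (A : Finset ℤ) : ℕ → Finset ℤ
  | 0 => {0}
  | n + 1 => hsum A n + A

theorem hsum_add_mem {A : Finset ℤ} {m n : ℕ} {x y : ℤ} (hx : x ∈ hsum A m)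
    (hy : y ∈ hsum A n) : x + y ∈ hsum A (m + n) := by
  induction n generalizing y with
  | zero =>
    obtain rfl : y = 0 := by simpa [hsum] using hy
    simpa using hx
  | succ n ih =>
    obtain ⟨z, hz, a, ha, rfl⟩ := Finset.mem_add.1 hy
    rw [← add_assoc x z a]
    exact Finset.add_mem_add (ih hz) ha

theorem mul_mem_hsum {A : Finset ℤ} {a : ℤ} (ha : a ∈ A) (n : ℕ) : (n : ℤ) * a ∈ hsum A n := by
  induction n with
  | zero => simp [hsum]
  | succ n ih =>
    have := Finset.add_mem_add ih ha
    push_cast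
    rw [add_mul, one_mul]
    exact this

theorem hsum_hsum_subset (A : Finset ℤ) (h r : ℕ) : hsum (hsum A h) r ⊆ hsum A (r * h) := by
  induction r with
  | zero => simp [hsum]
  | succ r ih =>
    intro x hx
    obtain ⟨y, hy, z, hz, rfl⟩ := Finset.mem_add.1 hx
    rw [add_mul, one_mul]
    exact hsum_add_mem (ih hy) hz

theorem hsum_bounds {A : Finset ℤ} {a b : ℤ} (ha : ∀ x ∈ A, x ≤ a) (hb : ∀ x ∈ A, b ≤ x)
    {n : ℕ} {x : ℤ} (hx : x ∈ hsum A n) : n * b ≤ x ∧ x ≤ n * a := by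
  induction n generalizing x with
  | zero => simp_all [hsum]
  | succ n ih =>
    obtain ⟨y, hy, z, hz, rfl⟩ := Finset.mem_add.1 hx
    have := ih hy
    have := ha z hz
    have := hb z hz
    push_cast
    constructor <;> linarith

/-- Elements of all sumsets of `A` differ from elements of one fixed sumset only by
copies of the extreme elements of `A`. -/
theorem exists_hsum_decomposition {A : Finset ℤ} {a b : ℤ} (hbA : b ∈ A)
    (ha : ∀ x ∈ A, x ≤ a) (hb : ∀ x ∈ A, b ≤ x) :
    ∃ K : ℕ, ∀ N : ℕ, ∀ n ∈ hsum A N, ∃ s ∈ hsum A K, ∃ m : ℕ, m ≤ N ∧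
      n = s + m * a + ((N : ℤ) - K - m) * b := by
  obtain ⟨d, hd⟩ := Int.eq_ofNat_of_zero_le (sub_nonneg.2 (ha b hbA))
  have hres : ∀ c : ℕ, ∃ K : ℕ, ∀ (x N : ℕ), (x : ℤ) + N * b ∈ hsum A N → x % d = c →
      ∃ y : ℕ, (y : ℤ) + K * b ∈ hsum A K ∧ y ≤ x ∧ y % d = c := by
    intro c
    by_cases hne : ∃ x : ℕ, x % d = c ∧ ∃ N : ℕ, (x : ℤ) + N * b ∈ hsum A N
    · classical
      obtain ⟨hc, K, hK⟩ := Nat.find_spec hne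
      exact ⟨K, fun x N hx hxc => ⟨_, hK, Nat.find_min' hne ⟨hxc, N, hx⟩, hc⟩⟩
    · exact ⟨0, fun x N hx hxc => absurd ⟨x, hxc, N, hx⟩ hne⟩
  choose K hK using hres
  refine ⟨(Finset.range (d + 1)).sup K, fun N n hn => ?_⟩
  obtain ⟨hlo, hhi⟩ := hsum_bounds ha hb hn
  obtain ⟨x, hx⟩ := Int.eq_ofNat_of_zero_le (sub_nonneg.2 hlo)
  have hxN : x ≤ N * d := by
    zify
    rw [← hx, ← hd]
    linarith
  have hxd : x % d ∈ Finset.range (d + 1) := by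
    rw [Finset.mem_range]
    rcases Nat.eq_zero_or_pos d with rfl | hpos
    · simp at hxN ⊢
      exact hxN
    · exact (Nat.mod_lt x hpos).trans (Nat.lt_succ_self d)
  obtain ⟨y, hy, hyx, hyd⟩ := hK _ x N (by rw [← hx]; simpa using hn) rfl
  have hle := Finset.le_sup (f := K) hxd
  generalize (Finset.range (d + 1)).sup K = M at hle ⊢
  refine ⟨y + M * b, ?_, (x - y) / d, ?_, ?_⟩
  · have := hsum_add_mem hy (mul_mem_hsum hbA (M - K (x % d)))
    rw [Nat.add_sub_cancel' hle] at this
    convert this using 1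
    push_cast [hle]
    ring
  · exact Nat.div_le_of_le_mul ((Nat.sub_le x y).trans (by rwa [mul_comm] at hxN))
  · have hdvd : d ∣ x - y := (Nat.modEq_iff_dvd' hyx).1 hyd
    have hmul : (((x - y) / d : ℕ) : ℤ) * d = x - y := by
      rw [← Nat.cast_mul, Nat.div_mul_cancel hdvd, Nat.cast_sub hyx]
    have ha' : a = b + d := by linarith
    rw [ha']
    linear_combination hx - hmul

/-- For every integer `r ≥ 2`, every nonempty finite set `A` of integers is an
asymptotic `(r, r+1)`-approximate group: there is a positive integer `h₁` such that
for all `h ≥ h₁` there is a set `X` of integers with `|X| ≤ r + 1` and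
`r(hA) ⊆ X + hA`. -/
theorem finite_set_asymptotic_approximate_group
    (r : ℕ) (hr : 2 ≤ r) (A : Finset ℤ) (hA : A.Nonempty) :
    ∃ h₁ : ℕ, 0 < h₁ ∧ ∀ h : ℕ, h₁ ≤ h →
      ∃ X : Finset ℤ, X.card ≤ r + 1 ∧ hsum (hsum A h) r ⊆ X + hsum A h := by
  obtain ⟨K, hK⟩ := exists_hsum_decomposition (a := A.max' hA) (A.min'_mem hA)
    (fun x hx => A.le_max' x hx)
    (fun x hx => A.min'_le x hx)
  have haA := A.max'_mem hA
  have hbA := A.min'_mem hA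
  generalize A.max' hA = a at *
  generalize A.min' hA = b at *
  refine ⟨K + r * K + 1, by omega, fun h hh => ?_⟩
  obtain ⟨e, rfl⟩ : ∃ e, h = K + e := ⟨h - K, by omega⟩
  refine ⟨(Finset.range (r + 1)).image fun t : ℕ =>
    (t : ℤ) * (e + 1) * (a - b) + ((r : ℤ) - 1) * (K + e) * b,
    Finset.card_image_le.trans (by simp), fun n hn => ?_⟩
  obtain ⟨s, hs, m, hm, rfl⟩ := hK _ n (hsum_hsum_subset A _ r hn)
  have hdiv := Nat.div_add_mod m (e + 1)
  have hmod := Nat.mod_lt m (Nat.succ_pos e)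
  have ht : m / (e + 1) < r + 1 := by
    rw [Nat.div_lt_iff_lt_mul (Nat.succ_pos e)]
    nlinarith
  generalize m / (e + 1) = t at *
  generalize m % (e + 1) = q at *
  obtain ⟨p, rfl⟩ : ∃ p, e = q + p := ⟨e - q, by omega⟩
  refine Finset.mem_add.2 ⟨_, Finset.mem_image_of_mem _ (Finset.mem_range.2 ht),
    s + (q * a + p * b),
    hsum_add_mem hs (hsum_add_mem (mul_mem_hsum haA q) (mul_mem_hsum hbA p)), ?_⟩
  subst hdiv
  push_cast
  ring
end

section
/- Let A be a finite set of integers with |A| ≥ 2 and let r ≥ 2 be an integer. Then A is an (r,2)-approximate group if and only if either r = 2 and A is an arithmetic progression, or r = 3 and |A| = 2. -/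
open Pointwise

/-- `A` is an `(r, ℓ)`-approximate group: there is a set `X` of integers with
`|X| ≤ ℓ` and `rA ⊆ X + A`. -/
def IsApproxGroup (r ℓ : ℕ) (A : Finset ℤ) : Prop :=
  ∃ X : Finset ℤ, X.card ≤ ℓ ∧ hsum A r ⊆ X + A

/-- `A` is a (finite, nonempty) arithmetic progression of integers:
`A = {a₀ + i·d : i = 0, 1, …, k−1}` for some integers `a₀`, `d` and positive `k`. -/
def IsAP (A : Finset ℤ) : Prop :=
  ∃ (a₀ d : ℤ) (k : ℕ), 0 < k ∧ A = (Finset.range k).image fun i : ℕ => a₀ + (i : ℤ) * d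

lemma hsum_nonempty_and_le_card {A : Finset ℤ} (hA : A.Nonempty) (r : ℕ) :
    (hsum A r).Nonempty ∧ r * (A.card - 1) + 1 ≤ (hsum A r).card := by
  induction r with
  | zero => simp [hsum]
  | succ n ih =>
    obtain ⟨hne, hc⟩ := ih
    refine ⟨hne.add hA, ?_⟩
    have h := cauchy_davenport_add_of_linearOrder_isCancelAdd hne hA
    have hpos := hA.card_pos
    rw [Nat.succ_mul]
    change _ ≤ (hsum A n + A).card
    omega

lemma mem_hsum_two {A : Finset ℤ} {z : ℤ} :
    z ∈ hsum A 2 ↔ ∃ a ∈ A, ∃ b ∈ A, a + b = z := by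
  simp [hsum, Finset.mem_add]

lemma mem_hsum_three {A : Finset ℤ} {z : ℤ} :
    z ∈ hsum A 3 ↔ ∃ a ∈ A, ∃ b ∈ A, ∃ c ∈ A, a + b + c = z := by
  simp [hsum, Finset.mem_add]

/-- A finite set that is stable under translation by `t ≠ 0` except at one of its points is an
arithmetic progression. -/
lemma isAP_of_add_mem {A : Finset ℤ} {c t : ℤ} (hc : c ∈ A) (ht : t ≠ 0)
    (h : ∀ a ∈ A, a ≠ c → a + t ∈ A) : IsAP A := by
  have hinj : Function.Injective fun i : ℕ => c - i * t := by
    intro i j hij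
    have : (i : ℤ) * t = j * t := by
      simp only at hij
      linarith
    exact_mod_cast mul_right_cancel₀ ht this
  have hreach : ∀ a ∈ A, ∃ i : ℕ, a = c - i * t := by
    intro a ha
    by_contra! hne
    have hall : ∀ i : ℕ, a + i * t ∈ A := by
      intro i
      induction i with
      | zero => simpa using ha
      | succ n ih =>
        have := h _ ih fun e => hne n (by linarith)
        convert this using 1
        push_cast
        ring
    refine Set.infinite_of_injective_forall_mem (f := fun i : ℕ => a + i * t) ?_ hall
      A.finite_toSet
    intro i j hij
    have : (i : ℤ) * t = j * t := by
      simp only at hij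
      linarith
    exact_mod_cast mul_right_cancel₀ ht this
  have hfin : {i : ℕ | c - i * t ∈ A}.Finite := A.finite_toSet.preimage hinj.injOn
  obtain ⟨N, hN, hmax⟩ := hfin.toFinset.exists_max_image id ⟨0, by simpa using hc⟩
  simp only [Set.Finite.mem_toFinset, Set.mem_ofPred_eq, id] at hN hmax
  have hdown : ∀ j i : ℕ, i + j = N → c - i * t ∈ A := by
    intro j
    induction j with
    | zero =>
      intro i hi
      rw [← hi] at hN
      exact hN
    | succ j ih =>
      intro i hi
      have := h _ (ih (i + 1) (by omega)) fun e => by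
        have := @hinj (i + 1) 0 (by simpa using e)
        omega
      convert this using 1
      push_cast
      ring
  refine ⟨c, -t, N + 1, N.succ_pos, ?_⟩
  ext a
  simp only [Finset.mem_image, Finset.mem_range]
  constructor
  · intro ha
    obtain ⟨i, rfl⟩ := hreach a ha
    exact ⟨i, Nat.lt_succ_of_le (hmax i ha), by ring⟩
  · rintro ⟨i, hi, rfl⟩
    have := hdown (N - i) i (by omega)
    convert this using 1
    ring

/-- A finite set `A` with at least two elements such that `A + A` is covered by two translates
of `A` is an arithmetic progression. -/
lemma isAP_of_add_sub_mem {A : Finset ℤ} (hA : 2 ≤ A.card) {x y : ℤ} (hxy : x ≤ y)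
    (h : ∀ a ∈ A, ∀ b ∈ A, a + b - x ∈ A ∨ a + b - y ∈ A) : IsAP A := by
  have hne : A.Nonempty := Finset.card_pos.mp (by omega)
  obtain ⟨m, hm, hmin⟩ := A.exists_min_image id hne
  obtain ⟨M, hM, hmax⟩ := A.exists_max_image id hne
  simp only [id] at hmin hmax
  have hxm : x ≤ m := by
    rcases h m hm m hm with h' | h' <;> linarith [hmin _ h']
  have hMy : M ≤ y := by
    rcases h M hM M hM with h' | h' <;> linarith [hmax _ h']
  rcases hxm.lt_or_eq with hlt | rfl
  · have hall : m + M - y ∈ A := (h m hm M hM).resolve_left fun h' => by linarith [hmax _ h']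
    have hy : y = M := by linarith [hmin _ hall]
    refine isAP_of_add_mem hM (t := m - x) (by omega) fun a ha haM => ?_
    have := (h a ha m hm).resolve_right fun h' => haM (by linarith [hmin _ h', hmax a ha])
    convert this using 1
    ring
  · rcases hMy.lt_or_eq with hlt | rfl
    · refine isAP_of_add_mem hm (t := M - y) (by omega) fun a ha hax => ?_
      have := (h a ha M hM).resolve_left fun h' => hax (by linarith [hmax _ h', hmin a ha])
      convert this using 1
      ring
    · have hne' : (A.erase x).Nonempty :=
        Finset.card_pos.mp (by rw [Finset.card_erase_of_mem hm]; omega)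
      obtain ⟨d, hd, hdmin⟩ := (A.erase x).exists_min_image id hne'
      simp only [id, Finset.mem_erase] at hd hdmin
      refine isAP_of_add_mem hM (t := d - x) (by have := hd.1; omega) fun a ha haM => ?_
      rcases h a ha d hd.2 with h' | h'
      · convert h' using 1
        ring
      · have haM' := lt_of_le_of_ne (hmax a ha) haM
        have hx : a + d - M = x := by
          by_contra hcon
          linarith [hdmin _ ⟨hcon, h'⟩]
        convert hM using 1
        linarith

lemma IsApproxGroup.isAP {A : Finset ℤ} (hA : 2 ≤ A.card) (h : IsApproxGroup 2 2 A) :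
    IsAP A := by
  obtain ⟨X, hX, hsub⟩ := h
  obtain ⟨x, y, hxy, hXxy⟩ : ∃ x y : ℤ, x ≤ y ∧ ∀ z ∈ X, z = x ∨ z = y := by
    rcases X.eq_empty_or_nonempty with rfl | hne
    · exact ⟨0, 0, le_rfl, by simp⟩
    · refine ⟨X.min' hne, X.max' hne, X.min'_le_max' hne, fun z hz => ?_⟩
      by_contra! hcon
      have hlt₁ := lt_of_le_of_ne (X.min'_le z hz) hcon.1.symm
      have hlt₂ := lt_of_le_of_ne (X.le_max' z hz) hcon.2
      have : ({X.min' hne, z, X.max' hne} : Finset ℤ) ⊆ X := by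
        simp [Finset.insert_subset_iff, hz, X.min'_mem hne, X.max'_mem hne]
      have hle := Finset.card_le_card this
      rw [Finset.card_eq_three.mpr ⟨_, _, _, hlt₁.ne, (hlt₁.trans hlt₂).ne, hlt₂.ne, rfl⟩] at hle
      omega
  refine isAP_of_add_sub_mem hA hxy fun a ha b hb => ?_
  obtain ⟨z, hz, w, hw, hzw⟩ := Finset.mem_add.mp (hsub (mem_hsum_two.mpr ⟨a, ha, b, hb, rfl⟩))
  rcases hXxy z hz with rfl | rfl
  · exact Or.inl (by rwa [← hzw, add_sub_cancel_left])
  · exact Or.inr (by rwa [← hzw, add_sub_cancel_left])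

lemma IsAP.isApproxGroup {A : Finset ℤ} (h : IsAP A) : IsApproxGroup 2 2 A := by
  obtain ⟨a₀, d, k, hk, rfl⟩ := h
  refine ⟨{a₀, a₀ + (k - 1 : ℕ) * d}, Finset.card_le_two, fun z hz => ?_⟩
  obtain ⟨a, ha, b, hb, rfl⟩ := mem_hsum_two.mp hz
  simp only [Finset.mem_image, Finset.mem_range] at ha hb
  obtain ⟨i, hi, rfl⟩ := ha
  obtain ⟨j, hj, rfl⟩ := hb
  rw [Finset.mem_add]
  by_cases hij : i + j < k
  · refine ⟨a₀, by simp, a₀ + (i + j : ℕ) * d,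
      Finset.mem_image.mpr ⟨i + j, by simpa using hij, rfl⟩, ?_⟩
    push_cast
    ring
  · refine ⟨a₀ + (k - 1 : ℕ) * d, by simp, a₀ + (i + j - (k - 1) : ℕ) * d,
      Finset.mem_image.mpr ⟨i + j - (k - 1), by simp; omega, rfl⟩, ?_⟩
    have : ((k - 1 : ℕ) : ℤ) + (i + j - (k - 1) : ℕ) = i + j := by omega
    linear_combination d * this

lemma isApproxGroup_three_of_card_eq_two {A : Finset ℤ} (h : A.card = 2) :
    IsApproxGroup 3 2 A := by
  obtain ⟨a, b, -, rfl⟩ := Finset.card_eq_two.mp h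
  refine ⟨{2 * a, 2 * b}, Finset.card_le_two, fun z hz => ?_⟩
  obtain ⟨u, hu, v, hv, w, hw, rfl⟩ := mem_hsum_three.mp hz
  simp only [Finset.mem_insert, Finset.mem_singleton] at hu hv hw
  simp only [Finset.mem_add, Finset.mem_insert, Finset.mem_singleton, exists_eq_or_imp,
    exists_eq_left]
  omega

/-- A finite set `A` of integers with `|A| ≥ 2` is an `(r,2)`-approximate group
(for an integer `r ≥ 2`) if and only if either `r = 2` and `A` is an arithmetic
progression, or `r = 3` and `|A| = 2`. -/
theorem approx_group_r_two_iff
    (A : Finset ℤ) (hA : 2 ≤ A.card) (r : ℕ) (hr : 2 ≤ r) :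
    IsApproxGroup r 2 A ↔ (r = 2 ∧ IsAP A) ∨ (r = 3 ∧ A.card = 2) := by
  constructor
  · intro h
    rcases hr.eq_or_lt with rfl | hr3
    · exact Or.inl ⟨rfl, h.isAP hA⟩
    · right
      obtain ⟨X, hX, hsub⟩ := h
      have hlow := (hsum_nonempty_and_le_card (Finset.card_pos.mp (by omega : 0 < A.card)) r).2
      have hup : (hsum A r).card ≤ 2 * A.card :=
        (Finset.card_le_card hsub).trans
          (Finset.card_add_le.trans (Nat.mul_le_mul_right _ hX))
      obtain ⟨k, hk⟩ := Nat.exists_eq_add_of_le hA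
      obtain ⟨s, rfl⟩ := Nat.exists_eq_add_of_le (Nat.succ_le_of_lt hr3)
      have hk' : A.card - 1 = k + 1 := by omega
      rw [hk'] at hlow
      have : s + k ≤ 0 := by nlinarith [Nat.zero_le (s * k)]
      omega
  · rintro (⟨rfl, h⟩ | ⟨rfl, h⟩)
    · exact h.isApproxGroup
    · exact isApproxGroup_three_of_card_eq_two h
end

section
/- Let A be a finite set of integers with |A| ≥ 2. If A is a (2,2)-approximate group, then A is an arithmetic progression. -/
open Pointwise

/-- A finite set of integers that is closed under a nonzero translation, except at a single
element `e`, is an arithmetic progression. -/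
theorem isAP_of_add_mem_of_ne {A : Finset ℤ} {e p : ℤ} (he : e ∈ A) (hp : p ≠ 0)
    (hstep : ∀ a ∈ A, a ≠ e → a + p ∈ A) : IsAP A := by
  have not_forall_mem : ∀ (b q : ℤ), q ≠ 0 → ∃ j : ℕ, b + (j : ℤ) * q ∉ A := by
    intro b q hq
    by_contra! hmem
    have hinj : Function.Injective fun j : ℕ => b + (j : ℤ) * q := by
      intro i j hij
      have h : (i : ℤ) * q = j * q := add_left_cancel hij
      exact_mod_cast mul_right_cancel₀ hq h
    exact Set.infinite_of_injective_forall_mem hinj hmem A.finite_toSet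
  have exists_eq : ∀ a ∈ A, ∃ j : ℕ, a = e + (j : ℤ) * (-p) := by
    intro a ha
    by_contra! hne
    obtain ⟨j, hj⟩ := not_forall_mem a p hp
    refine hj ?_
    clear hj
    induction j with
    | zero => simpa using ha
    | succ j ih =>
      have h := hstep _ ih fun h => hne j (by linarith)
      convert h using 1
      push_cast
      ring
  have hex := not_forall_mem e (-p) (neg_ne_zero.mpr hp)
  classical
  have not_mem_of_le : ∀ j, Nat.find hex ≤ j → e + (j : ℤ) * (-p) ∉ A := by
    intro j hj
    induction j, hj using Nat.le_induction with
    | base => exact Nat.find_spec hex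
    | succ j _ ih =>
      intro hmem
      refine ih ?_
      have hne : e + ((j + 1 : ℕ) : ℤ) * (-p) ≠ e := by
        intro h
        have h0 : ((j + 1 : ℕ) : ℤ) * (-p) = 0 := by linarith
        rcases mul_eq_zero.mp h0 with h1 | h1
        · omega
        · exact hp (neg_eq_zero.mp h1)
      convert hstep _ hmem hne using 1
      push_cast
      ring
  refine ⟨e, -p, Nat.find hex, ?_, ?_⟩
  · rw [Nat.find_pos]
    simpa using he
  · ext a
    simp only [Finset.mem_image, Finset.mem_range]
    constructor
    · intro ha
      obtain ⟨j, rfl⟩ := exists_eq a ha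
      exact ⟨j, not_le.mp fun h => not_mem_of_le j h ha, rfl⟩
    · rintro ⟨j, hj, rfl⟩
      exact not_not.mp (Nat.find_min hex hj)

/-- If a finite set `A` of integers with `|A| ≥ 2` is a `(2,2)`-approximate group,
then `A` is an arithmetic progression. -/
theorem two_two_approx_group_is_ap
    (A : Finset ℤ) (hA : 2 ≤ A.card) (h : IsApproxGroup 2 2 A) :
    IsAP A := by
  obtain ⟨X, hX, hsub⟩ := h
  have hne : A.Nonempty := Finset.card_pos.mp (by omega)
  obtain ⟨m, hm, hmin⟩ := A.exists_min_image id hne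
  obtain ⟨M, hM, hmax⟩ := A.exists_max_image id hne
  simp only [id] at hmin hmax
  obtain ⟨c, hc, hcm⟩ := A.exists_mem_ne (by omega) m
  have hmM : m < M := by
    have := hmin c hc
    have := hmax c hc
    omega
  have hcover : ∀ a ∈ A, ∀ b ∈ A, ∃ x ∈ X, a + b - x ∈ A := by
    intro a ha b hb
    have hab : a + b ∈ hsum A 2 := by
      simpa [hsum, Finset.singleton_zero] using Finset.add_mem_add ha hb
    obtain ⟨x, hx, a', ha', h⟩ := Finset.mem_add.mp (hsub hab)
    exact ⟨x, hx, by rwa [← h, add_sub_cancel_left]⟩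
  obtain ⟨x, hx, hxm⟩ := hcover m hm m hm
  obtain ⟨y, hy, hyM⟩ := hcover M hM M hM
  have hxle : x ≤ m := by linarith [hmin _ hxm]
  have hley : M ≤ y := by linarith [hmax _ hyM]
  have hXeq : ({x, y} : Finset ℤ) = X := by
    refine Finset.eq_of_subset_of_card_le (by simp [Finset.insert_subset_iff, hx, hy]) ?_
    rwa [Finset.card_pair (by omega)]
  have hpair : ∀ a ∈ A, ∀ b ∈ A, a + b - x ∈ A ∨ a + b - y ∈ A := by
    intro a ha b hb
    simpa [← hXeq] using hcover a ha b hb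
  rcases hxle.lt_or_eq with hxlt | rfl
  · refine isAP_of_add_mem_of_ne hM (p := m - x) (by omega) fun a ha haM => ?_
    rcases hpair a ha m hm with h | h
    · rwa [← add_sub_assoc]
    · have := hmin _ h
      have := hmax a ha
      omega
  rcases hley.lt_or_eq with hylt | rfl
  · refine isAP_of_add_mem_of_ne hm (p := M - y) (by omega) fun a ha ham => ?_
    rcases hpair a ha M hM with h | h
    · have := hmax _ h
      have := hmin a ha
      omega
    · rwa [← add_sub_assoc]
  obtain ⟨b, hb, hbmin⟩ := (A.erase x).exists_min_image id ⟨c, Finset.mem_erase.mpr ⟨hcm, hc⟩⟩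
  obtain ⟨hbx, hbA⟩ := Finset.mem_erase.mp hb
  simp only [id] at hbmin
  refine isAP_of_add_mem_of_ne hM (p := b - x) (by omega) fun a ha haM => ?_
  rcases hpair a ha b hbA with h | h
  · rwa [← add_sub_assoc]
  · have hlt := hmax a ha
    have heq : a + b - M = x := by
      by_contra hne'
      have := hbmin _ (Finset.mem_erase.mpr ⟨hne', h⟩)
      omega
    rwa [show a + (b - x) = M by omega]
end

section
/- Let u₀, u, v, v₀ be integers with u₀ ≤ u ≤ v ≤ v₀, and let A be a set of integers with {u₀, v₀} ∪ [u, v] ⊆ A ⊆ [u₀, v₀], where [u,v] denotes the interval of integers {n : u ≤ n ≤ v}. Let r ≥ 2 be an integer, and let ℓ be a positive integer satisfying ℓ ≥ (r(v₀ − u₀) + 1)/(v − u + 1). If X_ℓ = {r·u₀ − u + i(v − u + 1) : i = 0, 1, …, ℓ−1}, then rA ⊆ X_ℓ + A. -/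
open Pointwise

/-- The `r`-fold sumset `A + A + ⋯ + A` of a set of integers. -/
def ssum (A : Set ℤ) : ℕ → Set ℤ
  | 0 => {0}
  | n + 1 => ssum A n + A

/-- The `r`-fold sumset of a subset of `[a, b]` lies in `[r a, r b]`. -/
theorem ssum_subset_Icc {A : Set ℤ} {a b : ℤ} (hA : A ⊆ Set.Icc a b) (r : ℕ) :
    ssum A r ⊆ Set.Icc (r * a) (r * b) := by
  induction r with
  | zero => simp [ssum]
  | succ n ih =>
    rintro _ ⟨x, hx, y, hy, rfl⟩
    obtain ⟨hx₁, hx₂⟩ := ih hx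
    obtain ⟨hy₁, hy₂⟩ := hA hy
    simp only [Set.mem_Icc]
    push_cast
    constructor <;> linarith

/-- Let `u₀ ≤ u ≤ v ≤ v₀` be integers and let `A` be a set of integers with
`{u₀, v₀} ∪ [u,v] ⊆ A ⊆ [u₀,v₀]`.  Let `r ≥ 2` and let `ℓ ≥ 1` satisfy
`ℓ ≥ (r(v₀ − u₀) + 1)/(v − u + 1)`.  If
`X_ℓ = {r·u₀ − u + i(v − u + 1) : i = 0, 1, …, ℓ−1}`, then `rA ⊆ X_ℓ + A`. -/
theorem rsum_subset_X_add
    (u₀ u v v₀ : ℤ) (h1 : u₀ ≤ u) (h2 : u ≤ v) (h3 : v ≤ v₀)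
    (A : Set ℤ)
    (hA1 : ({u₀, v₀} : Set ℤ) ∪ Set.Icc u v ⊆ A)
    (hA2 : A ⊆ Set.Icc u₀ v₀)
    (r : ℕ) (hr : 2 ≤ r)
    (ℓ : ℕ) (hℓ : 0 < ℓ)
    (hineq : ((r * (v₀ - u₀) + 1 : ℤ) : ℚ) / ((v - u + 1 : ℤ) : ℚ) ≤ (ℓ : ℚ)) :
    ssum A r ⊆
      (↑((Finset.range ℓ).image fun i : ℕ => (r : ℤ) * u₀ - u + (i : ℤ) * (v - u + 1)) : Set ℤ)
        + A := by
  intro n hn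
  obtain ⟨hn₁, hn₂⟩ := ssum_subset_Icc hA2 r hn
  have hm : 0 < v - u + 1 := by linarith
  have hlen : r * (v₀ - u₀) + 1 ≤ ℓ * (v - u + 1) := by
    rw [div_le_iff₀ (by exact_mod_cast hm)] at hineq
    exact_mod_cast hineq
  have hdiv := Int.emod_add_mul_ediv (n - r * u₀) (v - u + 1)
  have hmod₁ := Int.emod_nonneg (n - r * u₀) hm.ne'
  have hmod₂ := Int.emod_lt_of_pos (n - r * u₀) hm
  have hq₁ : 0 ≤ (n - r * u₀) / (v - u + 1) := Int.ediv_nonneg (by linarith) hm.le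
  have hq₂ : (n - r * u₀) / (v - u + 1) < ℓ := Int.ediv_lt_of_lt_mul hm (by linarith)
  obtain ⟨i, hi⟩ := Int.eq_ofNat_of_zero_le hq₁
  rw [hi] at hdiv hq₂
  refine Set.mem_add.2 ⟨r * u₀ - u + i * (v - u + 1), ?_,
    u + (n - r * u₀) % (v - u + 1), hA1 (Or.inr ⟨by linarith, by linarith⟩), by linarith⟩
  exact Finset.mem_coe.2
    (Finset.mem_image.2 ⟨i, Finset.mem_range.2 (by exact_mod_cast hq₂), rfl⟩)
end
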